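/- Let r > 0, t₀ > 0 and M ≥ 0, and let g : ℝ → ℝ be C¹ with 0 ≤ g(t) ≤ 1 and 0 ≤ g′(t) ≤ M for all t, and with g(t) = 0 for all t ≤ t₀. Define R(t) = (1 − g(t))·R̃ᵣ(t). Then for every t ≥ t₀ one has 0 ≤ R′(t) ≤ (r²/16)·(M/t₀ + 1/t₀²). (This is the estimate in the proof of Lemma 1.2.7(iv): by choosing the radius r small while keeping the cutoff g fixed, the monodromy of a standard fibration over the disc of radius r becomes a δ-wobbly Dehn twist for arbitrarily small δ.) -/

import Mathlib

/-! The estimate from the proof of Lemma 1.2.7(iv) of Seidel, "A long exact sequence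
for symplectic Floer cohomology": the derivative of the angle function
`R(t) = (1 − g(t))·R̃ᵣ(t)` of the monodromy of a standard fibration over the disc of
radius `r` is bounded by `(r²/16)·(M/t₀ + 1/t₀²)` for `t ≥ t₀`. -/

/-- The rotation function `R̃ₛ`. -/
noncomputable def Rtilde (s : ℝ) (t : ℝ) : ℝ :=
  t/2 - (1/2) * Real.sqrt (t^2 + s^2/4)

theorem Rtilde_nonpos (s t : ℝ) : Rtilde s t ≤ 0 := by
  have h : t ≤ √(t ^ 2 + s ^ 2 / 4) := Real.le_sqrt_of_sq_le (by nlinarith [sq_nonneg s])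
  unfold Rtilde
  linarith

theorem neg_Rtilde_le (s : ℝ) {t : ℝ} (ht : 0 < t) : -Rtilde s t ≤ s ^ 2 / 16 * (1 / t) := by
  have h : √(t ^ 2 + s ^ 2 / 4) ≤ t + s ^ 2 / 8 * (1 / t) := by
    refine Real.sqrt_le_iff.2 ⟨by positivity, ?_⟩
    have h1 : (t + s ^ 2 / 8 * (1 / t)) ^ 2 =
        t ^ 2 + s ^ 2 / 4 + (s ^ 2 / 8 * (1 / t)) ^ 2 := by
      field_simp
      ring
    rw [h1]
    linarith [sq_nonneg (s ^ 2 / 8 * (1 / t))]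
  unfold Rtilde
  linarith

theorem hasDerivAt_Rtilde (s : ℝ) {t : ℝ} (ht : 0 < t) :
    HasDerivAt (Rtilde s) (-Rtilde s t / √(t ^ 2 + s ^ 2 / 4)) t := by
  have hp : 0 < t ^ 2 + s ^ 2 / 4 := by positivity
  have h := ((hasDerivAt_id t).div_const 2).sub
    ((((hasDerivAt_pow 2 t).add_const (s ^ 2 / 4)).sqrt hp.ne').const_mul (1 / 2))
  refine h.congr_deriv ?_
  have := (Real.sqrt_pos.2 hp).ne'
  unfold Rtilde
  field_simp
  norm_num
  ring


theorem small_radius_wobbly_estimate (r t₀ M : ℝ) (hr : 0 < r) (ht₀ : 0 < t₀)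
    (hM : 0 ≤ M) (g : ℝ → ℝ) (hg : ContDiff ℝ 1 g)
    (hg01 : ∀ t : ℝ, 0 ≤ g t ∧ g t ≤ 1)
    (hg' : ∀ t : ℝ, 0 ≤ deriv g t ∧ deriv g t ≤ M)
    (hg0 : ∀ t : ℝ, t ≤ t₀ → g t = 0) :
    ∀ t : ℝ, t₀ ≤ t →
      0 ≤ deriv (fun u => (1 - g u) * Rtilde r u) t ∧
      deriv (fun u => (1 - g u) * Rtilde r u) t ≤ (r^2/16) * (M/t₀ + 1/t₀^2) := by
  intro t ht
  have htp : 0 < t := ht₀.trans_le ht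
  have hgd : HasDerivAt g (deriv g t) t := (hg.differentiable one_ne_zero t).hasDerivAt
  have hd : deriv (fun u => (1 - g u) * Rtilde r u) t =
      -deriv g t * Rtilde r t + (1 - g t) * (-Rtilde r t / √(t ^ 2 + r ^ 2 / 4)) :=
    ((hgd.const_sub 1).mul (hasDerivAt_Rtilde r htp)).deriv
  rw [hd]
  obtain ⟨hg0t, hg1t⟩ := hg01 t
  obtain ⟨hd0, hdM⟩ := hg' t
  have hS : t₀ ≤ √(t ^ 2 + r ^ 2 / 4) :=
    Real.le_sqrt_of_sq_le (by nlinarith [sq_nonneg r])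
  have hN : 0 ≤ -Rtilde r t := neg_nonneg.2 (Rtilde_nonpos r t)
  have hNle : -Rtilde r t ≤ r ^ 2 / 16 * (1 / t₀) :=
    (neg_Rtilde_le r htp).trans (by gcongr)
  have hQ : 0 ≤ -Rtilde r t / √(t ^ 2 + r ^ 2 / 4) := by positivity
  have hQle : -Rtilde r t / √(t ^ 2 + r ^ 2 / 4) ≤ r ^ 2 / 16 * (1 / t₀) / t₀ := by
    gcongr
  have h1 : deriv g t * -Rtilde r t ≤ M * (r ^ 2 / 16 * (1 / t₀)) := by gcongr
  have h2 : (1 - g t) * (-Rtilde r t / √(t ^ 2 + r ^ 2 / 4)) ≤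
      r ^ 2 / 16 * (1 / t₀) / t₀ :=
    (mul_le_of_le_one_left hQ (by linarith)).trans hQle
  have h3 : 0 ≤ deriv g t * -Rtilde r t := mul_nonneg hd0 hN
  have h4 : 0 ≤ (1 - g t) * (-Rtilde r t / √(t ^ 2 + r ^ 2 / 4)) :=
    mul_nonneg (by linarith) hQ
  have h5 : r ^ 2 / 16 * (M / t₀ + 1 / t₀ ^ 2) =
      M * (r ^ 2 / 16 * (1 / t₀)) + r ^ 2 / 16 * (1 / t₀) / t₀ := by
    field_simp
  constructor <;> linarith
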